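/- Evaluation formula: for every n ∈ ℤ, ev(E_n) = t^{-|n|/2}·∏_{j=1}^{|ñ|−1} (1 − q^j t²)/(1 − q^j t), where ev : L → F is the F-algebra homomorphism sending X to t^{-1/2}, and |ñ| = |n| if n > 0 and |ñ| = |n| + 1 if n ≤ 0. -/

import Mathlib

/-!
Nonsymmetric Macdonald polynomials of type A₁: the explicit Laurent polynomials `E n`
are eigenfunctions of the Dunkl-type operator `Y` with eigenvalue `q^{-n_#}`.

The ground field is `F = ℚ(u,v)` with `q = u⁴`, `t = v²`; the Laurent polynomials
`F[X, X⁻¹]` are regarded inside the ambient field `M = F(X)`, in which all operators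
are given by the same formulas (division by `X² - 1` is then unproblematic).
-/

noncomputable section

/-- The ground field `ℚ(u,v)`. -/
abbrev F : Type := RatFunc (RatFunc ℚ)

/-- `u`, with `q = u⁴` (so `u = q^{1/4}`). -/
def u : F := RatFunc.C RatFunc.X

/-- `v`, with `t = v²` (so `v = t^{1/2}`). -/
def v : F := RatFunc.X

/-- `q = u⁴`. -/
def q : F := u ^ 4

/-- `t = v²`. -/
def t : F := v ^ 2

/-- The ambient field `F(X)` containing the Laurent polynomials `F[X,X⁻¹]`. -/
abbrev M : Type := RatFunc F

/-- The variable `X`. -/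
def XM : M := RatFunc.X

/-- The involution `s : Xⁿ ↦ X⁻ⁿ` (the substitution `X ↦ X⁻¹`). -/
def sOp : M → M := RatFunc.eval RatFunc.C (XM⁻¹)

/-- The operator `π : Xⁿ ↦ q^{n/2} X⁻ⁿ` (the substitution `X ↦ q^{1/2} X⁻¹`). -/
def piOp : M → M := RatFunc.eval RatFunc.C (RatFunc.C (u ^ 2) * XM⁻¹)

/-- The Demazure-Lusztig operator
`T(f) = t^{1/2}·s(f) + (t^{1/2} - t^{-1/2})·(s(f) - f)/(X² - 1)`. -/
def TOp (f : M) : M :=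
  RatFunc.C v * sOp f + RatFunc.C (v - v⁻¹) * (sOp f - f) / (XM ^ 2 - 1)

/-- The operator `Y = π ∘ T`. -/
def YOp (f : M) : M := piOp (TOp f)

/-- The product `∏_{i=0}^{j-1} [(1-q^{n-i-1})(1-t qⁱ)]/[(1-q^{1+i})(1-t q^{n-i-1})]`. -/
def macProdPos (n j : ℕ) : F :=
  ∏ i ∈ Finset.range j,
    ((1 - q ^ ((n : ℤ) - i - 1)) * (1 - t * q ^ (i : ℤ))) /
      ((1 - q ^ ((i : ℤ) + 1)) * (1 - t * q ^ ((n : ℤ) - i - 1)))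

/-- The product `∏_{i=0}^{j-1} [(1-q^{n-i})(1-t qⁱ)]/[(1-q^{1+i})(1-t q^{n-i})]`. -/
def macProdNeg (n j : ℕ) : F :=
  ∏ i ∈ Finset.range j,
    ((1 - q ^ ((n : ℤ) - i)) * (1 - t * q ^ (i : ℤ))) /
      ((1 - q ^ ((i : ℤ) + 1)) * (1 - t * q ^ ((n : ℤ) - i)))

/-- `E_n` for `n ≥ 1`. -/
def Epos (n : ℕ) : M :=
  XM ^ (n : ℤ)
    + ∑ j ∈ Finset.Icc 1 (n / 2),
        RatFunc.C (q ^ ((n : ℤ) - j) * (1 - q ^ (j : ℤ)) / (1 - q ^ ((n : ℤ) - j)) *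
          macProdPos n j) * XM ^ (2 * (j : ℤ) - n)
    + ∑ j ∈ Finset.Icc 1 ((n - 1) / 2),
        RatFunc.C (q ^ (j : ℤ) * macProdPos n j) * XM ^ ((n : ℤ) - 2 * j)

/-- `E_{-n}` for `n ≥ 1`. -/
def Eneg (n : ℕ) : M :=
  XM ^ (-(n : ℤ))
    + RatFunc.C ((1 - t) / (1 - t * q ^ (n : ℤ))) * XM ^ (n : ℤ)
    + ∑ j ∈ Finset.Icc 1 (n / 2),
        RatFunc.C (macProdNeg n j) * XM ^ (2 * (j : ℤ) - n)
    + ∑ j ∈ Finset.Icc 1 ((n - 1) / 2),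
        RatFunc.C ((1 - t * q ^ (j : ℤ)) / (1 - t * q ^ ((n : ℤ) - j)) * macProdNeg n j) *
          XM ^ ((n : ℤ) - 2 * j)

/-- The nonsymmetric Macdonald polynomials `E_n`, `n ∈ ℤ`, given by the explicit formulas. -/
def E : ℤ → M := fun n => if 0 < n then Epos n.toNat else if n = 0 then 1 else Eneg (-n).toNat

/-- The evaluation homomorphism `ev : L → F`, the `F`-algebra homomorphism `X ↦ t^{-1/2}`. -/
def ev : M → F := RatFunc.eval (RingHom.id F) (v⁻¹)

/-- `|ñ| = |n|` if `n > 0` and `|n| + 1` if `n ≤ 0`. -/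
def ntilde (n : ℤ) : ℕ := if 0 < n then n.natAbs else n.natAbs + 1

section Aux

/-- `(a;q)_k / (q;q)_k`. -/
def hh {K : Type*} [Field K] (Q a : K) (k : ℕ) : K :=
  ∏ i ∈ Finset.range k, (1 - a * Q ^ i) / (1 - Q ^ (i + 1))

theorem hh_zero {K : Type*} [Field K] (Q a : K) : hh Q a 0 = 1 := by simp [hh]

theorem hh_succ {K : Type*} [Field K] (Q a : K) (hQ : ∀ m : ℕ, 1 - Q ^ (m + 1) ≠ 0) (k : ℕ) :
    (1 - Q ^ (k + 1)) * hh Q a (k + 1) = (1 - a * Q ^ k) * hh Q a k := by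
  have := hQ k
  rw [hh, Finset.prod_range_succ, ← hh]
  field_simp

theorem hh_shift {K : Type*} [Field K] (Q a : K) (hQ : ∀ m : ℕ, 1 - Q ^ (m + 1) ≠ 0) (k : ℕ) :
    (1 - a * Q ^ k) * hh Q a k = (1 - a) * hh Q (a * Q) k := by
  induction k with
  | zero => simp [hh_zero]
  | succ k ih =>
    have h1 := hh_succ Q a hQ k
    have h2 := hh_succ Q (a * Q) hQ k
    apply mul_left_cancel₀ (hQ k)
    linear_combination (1 - a * Q ^ (k + 1)) * h1 + (1 - a * Q ^ (k + 1)) * ih - (1 - a) * h2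

theorem vander {K : Type*} [Field K] (Q a b : K) (hQ : ∀ m : ℕ, 1 - Q ^ (m + 1) ≠ 0) (N : ℕ) :
    ∑ k ∈ Finset.range (N + 1), b ^ k * hh Q a k * hh Q b (N - k) = hh Q (a * b) N := by
  induction N with
  | zero => simp [hh_zero]
  | succ N ih =>
    apply mul_left_cancel₀ (hQ N)
    rw [hh_succ Q _ hQ, ← ih, Finset.mul_sum, Finset.mul_sum]
    have e : ∀ k ∈ Finset.range (N + 1 + 1),
        (1 - Q ^ (N + 1)) * (b ^ k * hh Q a k * hh Q b (N + 1 - k)) =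
        b ^ k * hh Q a k * ((1 - Q ^ (N + 1 - k)) * hh Q b (N + 1 - k)) +
        Q ^ (N + 1 - k) * b ^ k * ((1 - Q ^ k) * hh Q a k) * hh Q b (N + 1 - k) := by
      intro k hk
      have : k ≤ N + 1 := by simp at hk; omega
      have : Q ^ (N + 1) = Q ^ (N + 1 - k) * Q ^ k := by rw [← pow_add]; congr 1; omega
      rw [this]; ring
    rw [Finset.sum_congr rfl e, Finset.sum_add_distrib, Finset.sum_range_succ,
      Finset.sum_range_succ' (fun k => Q ^ (N + 1 - k) * b ^ k * ((1 - Q ^ k) * hh Q a k) *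
        hh Q b (N + 1 - k))]
    simp only [Nat.sub_self, pow_zero, sub_self, zero_mul, mul_zero, add_zero]
    rw [← Finset.sum_add_distrib]
    apply Finset.sum_congr rfl
    intro k hk
    have hk' : k ≤ N := by simp at hk; omega
    have h1 : N + 1 - k = (N - k) + 1 := by omega
    have h2 : N + 1 - (k + 1) = N - k := by omega
    have h3 : Q ^ N = Q ^ (N - k) * Q ^ k := by rw [← pow_add]; congr 1; omega
    rw [h1, h2, hh_succ Q b hQ, hh_succ Q a hQ, h3]
    ring

theorem one_sub_q_ne (m : ℕ) : (1 : F) - q ^ (m + 1) ≠ 0 := by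
  intro h
  have h1 : q ^ (m + 1) = 1 := (sub_eq_zero.mp h).symm
  rw [q, u, ← pow_mul, ← map_pow, ← map_one (RatFunc.C)] at h1
  replace h1 := RatFunc.C_injective h1
  rw [← RatFunc.algebraMap_X, ← map_pow, ← map_one (algebraMap (Polynomial ℚ) (RatFunc ℚ)),
    (RatFunc.algebraMap_injective ℚ).eq_iff] at h1
  have := congrArg Polynomial.natDegree h1
  simp at this

theorem u_ne : u ≠ 0 := by simp [u, RatFunc.X_ne_zero]
theorem v_ne : v ≠ 0 := RatFunc.X_ne_zero
theorem q_ne : q ≠ 0 := pow_ne_zero _ u_ne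

theorem one_sub_tq_ne (m : ℕ) : (1 : F) - t * q ^ m ≠ 0 := by
  intro h
  have h1 : t * q ^ m = 1 := (sub_eq_zero.mp h).symm
  rw [t, v, q, u, ← pow_mul, ← map_pow, ← RatFunc.algebraMap_C,
    ← RatFunc.algebraMap_X, ← map_pow, ← map_mul,
    ← map_one (algebraMap (Polynomial (RatFunc ℚ)) (RatFunc (RatFunc ℚ))),
    (RatFunc.algebraMap_injective _).eq_iff] at h1
  have := congrArg Polynomial.natDegree h1
  rw [Polynomial.natDegree_mul_C (pow_ne_zero _ RatFunc.X_ne_zero)] at this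
  simp at this

theorem hh_tq_ne (k : ℕ) : hh q (t * q) k ≠ 0 := by
  rw [hh, Finset.prod_ne_zero_iff]
  intro i _
  apply div_ne_zero _ (one_sub_q_ne i)
  have := one_sub_tq_ne (i + 1)
  rwa [pow_succ', ← mul_assoc] at this

theorem macProdNeg_eq (n j : ℕ) (hj : j ≤ n) :
    macProdNeg n j * hh q (t * q) n = hh q t j * hh q (t * q) (n - j) := by
  induction j with
  | zero => simp [macProdNeg, hh_zero]
  | succ j ih =>
    obtain ⟨m, rfl⟩ : ∃ m, n = m + 1 + j := ⟨n - 1 - j, by omega⟩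
    have ih := ih (by omega)
    have e1 : m + 1 + j - j = m + 1 := by omega
    have e2 : m + 1 + j - (j + 1) = m := by omega
    rw [e1] at ih
    rw [e2, macProdNeg, Finset.prod_range_succ, ← macProdNeg]
    have e3 : ((m + 1 + j : ℕ) : ℤ) - j = ((m + 1 : ℕ) : ℤ) := by push_cast; ring
    have e4 : (j : ℤ) + 1 = ((j + 1 : ℕ) : ℤ) := by push_cast; ring
    rw [e3, e4]
    simp only [zpow_natCast]
    have a1 := one_sub_q_ne j
    have a2 := one_sub_q_ne m
    have a3 := one_sub_tq_ne (m + 1)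
    have b1 := hh_succ q t one_sub_q_ne j
    have b2 := hh_succ q (t * q) one_sub_q_ne m
    have b3 : hh q t (j + 1) = (1 - t * q ^ j) * hh q t j / (1 - q ^ (j + 1)) := by
      field_simp; linear_combination b1
    rw [b3]
    generalize hh q t j = A at *
    generalize hh q (t * q) m = B at *
    generalize hh q (t * q) (m + 1) = B' at *
    generalize hh q (t * q) (m + 1 + j) = C at *
    generalize macProdNeg (m + 1 + j) j = P at *
    rw [mul_div_assoc', div_mul_eq_mul_div, div_mul_eq_mul_div, div_eq_div_iff (mul_ne_zero a1 a3) a1]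
    linear_combination (1 - q ^ (m + 1)) * (1 - t * q ^ j) * (1 - q ^ (j + 1)) * ih +
      A * (1 - t * q ^ j) * (1 - q ^ (j + 1)) * b2

theorem macProdPos_eq (n j : ℕ) : macProdPos (n + 1) j = macProdNeg n j := by
  unfold macProdPos macProdNeg
  apply Finset.prod_congr rfl
  intro i _
  have : ((n + 1 : ℕ) : ℤ) - i - 1 = (n : ℤ) - i := by push_cast; ring
  rw [this]

theorem neg_symm (n j : ℕ) (hj : j ≤ n) :
    (1 - t * q ^ j) / (1 - t * q ^ (n - j)) * macProdNeg n j = macProdNeg n (n - j) := by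
  have a := one_sub_tq_ne (n - j)
  apply mul_right_cancel₀ (hh_tq_ne n)
  rw [mul_assoc, macProdNeg_eq n j hj, macProdNeg_eq n (n - j) (by omega),
    show n - (n - j) = j by omega]
  have h1 := hh_shift q t one_sub_q_ne j
  have h2 := hh_shift q t one_sub_q_ne (n - j)
  rw [div_mul_eq_mul_div, div_eq_iff a]
  linear_combination hh q (t * q) (n - j) * h1 - hh q (t * q) j * h2

theorem pos_symm (i l : ℕ) :
    (1 - q ^ (i + 1)) / (1 - q ^ (l + 1)) * macProdNeg (i + l + 1) (i + 1) =
      macProdNeg (i + l + 1) (l + 1) := by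
  have a := one_sub_q_ne l
  apply mul_right_cancel₀ (hh_tq_ne (i + l + 1))
  rw [mul_assoc, macProdNeg_eq _ _ (by omega), macProdNeg_eq _ _ (by omega),
    show i + l + 1 - (i + 1) = l by omega, show i + l + 1 - (l + 1) = i by omega]
  have h1 := hh_shift q t one_sub_q_ne i
  have h2 := hh_shift q t one_sub_q_ne l
  have h3 := hh_succ q t one_sub_q_ne i
  have h4 := hh_succ q t one_sub_q_ne l
  rw [div_mul_eq_mul_div, div_eq_iff a]
  linear_combination hh q (t * q) l * (h1 + h3) - hh q (t * q) i * (h2 + h4)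

theorem prod_eq (n : ℕ) :
    (∏ j ∈ Finset.Icc 1 n, (1 - q ^ (j : ℤ) * t ^ 2) / (1 - q ^ (j : ℤ) * t)) * hh q (t * q) n =
      hh q (t * (t * q)) n := by
  induction n with
  | zero => simp [hh_zero]
  | succ n ih =>
    have a := one_sub_q_ne n
    have b := one_sub_tq_ne (n + 1)
    rw [Finset.prod_Icc_succ_top (by omega)]
    apply mul_left_cancel₀ a
    have h1 := hh_succ q (t * q) one_sub_q_ne n
    have h2 := hh_succ q (t * (t * q)) one_sub_q_ne n
    rw [h2, ← ih, zpow_natCast]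
    have b' : 1 - q ^ (n + 1) * t ≠ 0 := by rwa [mul_comm] at b
    generalize (∏ j ∈ Finset.Icc 1 n, (1 - q ^ (j : ℤ) * t ^ 2) / (1 - q ^ (j : ℤ) * t)) = P
    have : (1 - q ^ (n + 1) * t ^ 2) / (1 - q ^ (n + 1) * t) * (1 - t * q * q ^ n) =
        1 - t * (t * q) * q ^ n := by
      rw [div_mul_eq_mul_div, div_eq_iff b']; ring
    linear_combination P * ((1 - q ^ (n + 1) * t ^ 2) / (1 - q ^ (n + 1) * t)) * h1 +
      P * hh q (t * q) n * this

theorem sum_split (n : ℕ) (g : ℕ → F) :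
    g 0 + ∑ j ∈ Finset.Icc 1 ((n + 1) / 2), g (n + 1 - j) + ∑ j ∈ Finset.Icc 1 (n / 2), g j =
      ∑ k ∈ Finset.range (n + 1), g k := by
  have h1 : ∑ k ∈ Finset.range (n + 1), g k = ∑ k ∈ Finset.range (n / 2 + 1), g k +
      ∑ k ∈ Finset.Ico (n / 2 + 1) (n + 1), g k := by
    rw [Finset.sum_range_add_sum_Ico]; omega
  have h2 : ∑ j ∈ Finset.Icc 1 ((n + 1) / 2), g (n + 1 - j) =
      ∑ k ∈ Finset.Ico (n / 2 + 1) (n + 1), g k := by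
    apply Finset.sum_nbij' (fun j => n + 1 - j) (fun j => n + 1 - j)
    · intro j hj; simp at hj ⊢; omega
    · intro j hj; simp at hj ⊢; omega
    · intro j hj; simp at hj ⊢; omega
    · intro j hj; simp at hj ⊢; omega
    · intro j hj; rfl
  have h3 : ∑ k ∈ Finset.range (n / 2 + 1), g k = g 0 + ∑ j ∈ Finset.Icc 1 (n / 2), g j := by
    rw [Finset.range_eq_Ico, Finset.sum_eq_sum_Ico_succ_bot (by omega)]
    rfl
  rw [h1, h2, h3]; ring

/-- `f` is regular at the evaluation point, with value `c`. -/
def Reg (f : M) (c : F) : Prop :=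
  Polynomial.eval₂ (RingHom.id F) v⁻¹ f.denom ≠ 0 ∧ ev f = c

theorem Reg.add {f g : M} {a b : F} (hf : Reg f a) (hg : Reg g b) : Reg (f + g) (a + b) := by
  refine ⟨?_, ?_⟩
  · obtain ⟨r, hr⟩ := RatFunc.denom_add_dvd f g
    intro h
    have := congrArg (Polynomial.eval₂ (RingHom.id F) v⁻¹) hr
    rw [Polynomial.eval₂_mul, Polynomial.eval₂_mul, h, zero_mul] at this
    exact mul_ne_zero hf.1 hg.1 this
  · rw [← hf.2, ← hg.2]; exact RatFunc.eval_add _ _ hf.1 hg.1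

theorem Reg.mul {f g : M} {a b : F} (hf : Reg f a) (hg : Reg g b) : Reg (f * g) (a * b) := by
  refine ⟨?_, ?_⟩
  · obtain ⟨r, hr⟩ := RatFunc.denom_mul_dvd f g
    intro h
    have := congrArg (Polynomial.eval₂ (RingHom.id F) v⁻¹) hr
    rw [Polynomial.eval₂_mul, Polynomial.eval₂_mul, h, zero_mul] at this
    exact mul_ne_zero hf.1 hg.1 this
  · rw [← hf.2, ← hg.2]; exact RatFunc.eval_mul _ _ hf.1 hg.1

theorem Reg.C (c : F) : Reg (RatFunc.C c) c := by
  refine ⟨by simp, by simp [ev]⟩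

theorem Reg.X : Reg XM v⁻¹ := by
  refine ⟨by simp [XM], by simp [ev, XM]⟩

theorem Reg.Xinv : Reg XM⁻¹ v := by
  have hd : Polynomial.eval₂ (RingHom.id F) v⁻¹ (XM⁻¹).denom ≠ 0 := by
    have : (XM⁻¹).denom ∣ Polynomial.X := by
      have := RatFunc.denom_div_dvd (1 : Polynomial F) Polynomial.X
      simpa [XM] using this
    obtain ⟨r, hr⟩ := this
    intro h
    have := congrArg (Polynomial.eval₂ (RingHom.id F) v⁻¹) hr
    rw [Polynomial.eval₂_mul, h, zero_mul, Polynomial.eval₂_X] at this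
    exact inv_ne_zero v_ne this
  refine ⟨hd, ?_⟩
  have h := (Reg.mul Reg.X ⟨hd, rfl⟩).2
  have hx : XM * XM⁻¹ = 1 := mul_inv_cancel₀ (G₀ := M) (a := XM) RatFunc.X_ne_zero
  rw [hx] at h
  have h1 : ev 1 = 1 := by simp [ev]
  rw [h1] at h
  have hv := v_ne
  generalize ev XM⁻¹ = c at h ⊢
  field_simp at h
  exact h.symm

theorem Reg.pow {f : M} {a : F} (hf : Reg f a) (n : ℕ) : Reg (f ^ n) (a ^ n) := by
  induction n with
  | zero => simpa using Reg.C 1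
  | succ n ih => rw [pow_succ, pow_succ]; exact ih.mul hf

theorem Reg.zpow (n : ℤ) : Reg (XM ^ n) (v⁻¹ ^ n) := by
  obtain ⟨m, rfl | rfl⟩ := n.eq_nat_or_neg
  · simpa using Reg.X.pow m
  · have := Reg.Xinv.pow m
    have e : XM ^ (-(m : ℤ)) = XM⁻¹ ^ m :=
      (zpow_neg (α := M) XM (m : ℤ)).trans
        ((congrArg _ (zpow_natCast (G := M) XM m)).trans (inv_pow (α := M) XM m).symm)
    rw [e]
    simpa using this

theorem Reg.sum (s : Finset ℕ) (f : ℕ → M) (a : ℕ → F) (h : ∀ i, Reg (f i) (a i)) :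
    Reg (∑ i ∈ s, f i) (∑ i ∈ s, a i) := by
  induction s using Finset.cons_induction with
  | empty => simpa using Reg.C 0
  | cons i s hi ih => rw [Finset.sum_cons, Finset.sum_cons]; exact (h i).add ih

theorem vpow (n k : ℕ) : v⁻¹ ^ ((n : ℤ) - 2 * k) = v ^ (-(n : ℤ)) * t ^ k := by
  have hv := v_ne
  rw [inv_zpow', neg_sub, sub_eq_add_neg, zpow_add₀ hv, mul_comm, t, zpow_mul]
  simp

theorem ev_pos (n : ℕ) : ev (Epos (n + 1)) = v ^ (-((n + 1 : ℕ) : ℤ)) *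
      ∏ j ∈ Finset.Icc 1 n, (1 - q ^ (j : ℤ) * t ^ 2) / (1 - q ^ (j : ℤ) * t) := by
  have key : ev (Epos (n + 1)) = ∑ k ∈ Finset.range (n + 1),
      q ^ k * macProdNeg n k * v⁻¹ ^ (((n + 1 : ℕ) : ℤ) - 2 * k) := by
    unfold Epos
    rw [(((Reg.zpow _).add (Reg.sum _ _ _ fun j => (Reg.C _).mul (Reg.zpow _))).add
      (Reg.sum _ _ _ fun j => (Reg.C _).mul (Reg.zpow _))).2, ← sum_split]
    congr 1
    · congr 1
      · simp [macProdNeg]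
      · apply Finset.sum_congr rfl
        intro j hj
        rw [Finset.mem_Icc] at hj
        obtain ⟨i, rfl⟩ : ∃ i, j = i + 1 := ⟨j - 1, by omega⟩
        obtain ⟨l, rfl⟩ : ∃ l, n = i + l + 1 := ⟨n - i - 1, by omega⟩
        rw [macProdPos_eq, show i + l + 1 + 1 - (i + 1) = l + 1 by omega, ← pos_symm,
          show ((i + l + 1 + 1 : ℕ) : ℤ) - ((i + 1 : ℕ) : ℤ) = ((l + 1 : ℕ) : ℤ) by
            push_cast; ring,
          show 2 * ((i + 1 : ℕ) : ℤ) - ((i + l + 1 + 1 : ℕ) : ℤ) =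
            ((i + l + 1 + 1 : ℕ) : ℤ) - 2 * ((l + 1 : ℕ) : ℤ) by push_cast; ring]
        simp only [zpow_natCast]
        ring
    · apply Finset.sum_congr (by simp)
      intro j _
      rw [macProdPos_eq, zpow_natCast]
  rw [key]
  apply mul_right_cancel₀ (hh_tq_ne n)
  rw [mul_assoc, prod_eq, ← vander q t (t * q) one_sub_q_ne, Finset.sum_mul, Finset.mul_sum]
  apply Finset.sum_congr rfl
  intro k hk
  have := macProdNeg_eq n k (by simp at hk; omega)
  rw [vpow]
  linear_combination q ^ k * v ^ (-((n + 1 : ℕ) : ℤ)) * t ^ k * this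

theorem ev_neg (n : ℕ) : ev (Eneg (n + 1)) = v ^ (-((n + 1 : ℕ) : ℤ)) *
      ∏ j ∈ Finset.Icc 1 (n + 1), (1 - q ^ (j : ℤ) * t ^ 2) / (1 - q ^ (j : ℤ) * t) := by
  have key : ev (Eneg (n + 1)) = ∑ k ∈ Finset.range (n + 1 + 1),
      macProdNeg (n + 1) (n + 1 - k) * v⁻¹ ^ (((n + 1 : ℕ) : ℤ) - 2 * k) := by
    unfold Eneg
    rw [((((Reg.zpow _).add ((Reg.C _).mul (Reg.zpow _))).add
      (Reg.sum _ _ _ fun j => (Reg.C _).mul (Reg.zpow _))).add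
      (Reg.sum _ _ _ fun j => (Reg.C _).mul (Reg.zpow _))).2, Finset.sum_range_succ, ← sum_split]
    have e1 : v⁻¹ ^ (-((n + 1 : ℕ) : ℤ)) = macProdNeg (n + 1) (n + 1 - (n + 1)) *
        v⁻¹ ^ (((n + 1 : ℕ) : ℤ) - 2 * ((n + 1 : ℕ) : ℤ)) := by
      rw [show ((n + 1 : ℕ) : ℤ) - 2 * ((n + 1 : ℕ) : ℤ) = -((n + 1 : ℕ) : ℤ) by ring]
      simp [macProdNeg]
    have e2 : (1 - t) / (1 - t * q ^ ((n + 1 : ℕ) : ℤ)) = macProdNeg (n + 1) (n + 1 - 0) := by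
      rw [← neg_symm _ _ (by omega), zpow_natCast]
      simp [macProdNeg]
    have e3 : ∑ j ∈ Finset.Icc 1 ((n + 1) / 2), macProdNeg (n + 1) j *
          v⁻¹ ^ (2 * (j : ℤ) - ((n + 1 : ℕ) : ℤ)) =
        ∑ j ∈ Finset.Icc 1 ((n + 1) / 2), macProdNeg (n + 1) (n + 1 - (n + 1 - j)) *
          v⁻¹ ^ (((n + 1 : ℕ) : ℤ) - 2 * ((n + 1 - j : ℕ) : ℤ)) := by
      apply Finset.sum_congr rfl
      intro j hj
      rw [Finset.mem_Icc] at hj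
      rw [show n + 1 - (n + 1 - j) = j by omega, Nat.cast_sub (by omega)]
      congr 2
      ring
    have e4 : ∑ j ∈ Finset.Icc 1 ((n + 1 - 1) / 2), (1 - t * q ^ (j : ℤ)) /
          (1 - t * q ^ (((n + 1 : ℕ) : ℤ) - j)) * macProdNeg (n + 1) j *
          v⁻¹ ^ (((n + 1 : ℕ) : ℤ) - 2 * (j : ℤ)) =
        ∑ j ∈ Finset.Icc 1 (n / 2), macProdNeg (n + 1) (n + 1 - j) *
          v⁻¹ ^ (((n + 1 : ℕ) : ℤ) - 2 * (j : ℤ)) := by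
      apply Finset.sum_congr (by simp)
      intro j hj
      rw [Finset.mem_Icc] at hj
      rw [← neg_symm _ _ (by omega), ← Nat.cast_sub (by omega)]
      simp only [zpow_natCast]
    rw [e1, e2, e3, e4]
    simp only [Nat.cast_zero, mul_zero, sub_zero]
    ring
  rw [key]
  apply mul_right_cancel₀ (hh_tq_ne (n + 1))
  rw [mul_assoc, prod_eq, mul_comm t (t * q), ← vander q (t * q) t one_sub_q_ne, Finset.sum_mul,
    Finset.mul_sum]
  apply Finset.sum_congr rfl
  intro k hk
  have hk' : k ≤ n + 1 := by simp at hk; omega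
  have := macProdNeg_eq (n + 1) (n + 1 - k) (by omega)
  rw [show n + 1 - (n + 1 - k) = k by omega] at this
  rw [vpow]
  linear_combination v ^ (-((n + 1 : ℕ) : ℤ)) * t ^ k * this

end Aux

/-- Evaluation formula: `ev(E_n) = t^{-|n|/2}·∏_{j=1}^{|ñ|-1} (1 - qʲt²)/(1 - qʲt)`. -/
theorem macdonald_evaluation_formula (n : ℤ) :
    ev (E n) = v ^ (-(n.natAbs : ℤ)) *
      ∏ j ∈ Finset.Icc 1 (ntilde n - 1), (1 - q ^ (j : ℤ) * t ^ 2) / (1 - q ^ (j : ℤ) * t) := by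
  rcases lt_trichotomy 0 n with h | h | h
  · obtain ⟨m, rfl⟩ : ∃ m : ℕ, n = ((m + 1 : ℕ) : ℤ) := ⟨(n - 1).toNat, by omega⟩
    have e1 : E ((m + 1 : ℕ) : ℤ) = Epos (m + 1) := by
      rw [E, if_pos h, Int.toNat_natCast]
    have e2 : ntilde ((m + 1 : ℕ) : ℤ) - 1 = m := by
      rw [ntilde, if_pos h, Int.natAbs_natCast]; omega
    rw [e1, e2, ev_pos, Int.natAbs_natCast]
  · subst h
    simp [E, ntilde, ev]
  · obtain ⟨m, rfl⟩ : ∃ m : ℕ, n = -((m + 1 : ℕ) : ℤ) := ⟨(-n - 1).toNat, by omega⟩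
    have e1 : E (-((m + 1 : ℕ) : ℤ)) = Eneg (m + 1) := by
      rw [E, if_neg (by omega), if_neg (by omega), neg_neg, Int.toNat_natCast]
    have e2 : ntilde (-((m + 1 : ℕ) : ℤ)) - 1 = m + 1 := by
      rw [ntilde, if_neg (by omega), Int.natAbs_neg, Int.natAbs_natCast]; omega
    rw [e1, e2, ev_neg, Int.natAbs_neg, Int.natAbs_natCast]
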